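/- Let α ∈ ℝ and let F : ℝ^{m₁×m₂} × ℝ → ℝ^{m₁×m₂} satisfy ⟨F(Y,t), Y⟩ ≤ α‖Y‖_F² for all Y and t. Let Ũ ∈ ℝ^{m₁×s₁} and Ṽ ∈ ℝ^{m₂×s₂} have orthonormal columns, let Δt ≥ 0 with αΔt < 1, let X̂ⁿ ∈ ℝ^{m₁×m₂}, and suppose Σ̃ ∈ ℝ^{s₁×s₂} satisfies Σ̃ = Ũᵀ (X̂ⁿ + Δt · F(Ũ Σ̃ Ṽᵀ, t)) Ṽ. Then ‖Ũ Σ̃ Ṽᵀ‖_F ≤ (1 − αΔt)⁻¹ ‖X̂ⁿ‖_F, and consequently any matrix X̂ⁿ⁺¹ with ‖X̂ⁿ⁺¹‖_F ≤ ‖Ũ Σ̃ Ṽᵀ‖_F satisfies ‖X̂ⁿ⁺¹‖_F ≤ (1 − αΔt)⁻¹ ‖X̂ⁿ‖_F. -/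

import Mathlib

open Matrix

/-- Frobenius inner product of two real matrices. -/
noncomputable def finner {m₁ m₂ : ℕ} (A B : Matrix (Fin m₁) (Fin m₂) ℝ) : ℝ :=
  ∑ i, ∑ j, A i j * B i j

/-- Frobenius norm of a real matrix. -/
noncomputable def fnorm {m₁ m₂ : ℕ} (A : Matrix (Fin m₁) (Fin m₂) ℝ) : ℝ :=
  Real.sqrt (finner A A)

theorem finner_eq_trace {m₁ m₂ : ℕ} (A B : Matrix (Fin m₁) (Fin m₂) ℝ) :
    finner A B = (Aᵀ * B).trace := by
  simp only [finner, Matrix.trace, Matrix.diag, Matrix.mul_apply, Matrix.transpose_apply]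
  exact Finset.sum_comm

theorem finner_comm {m₁ m₂ : ℕ} (A B : Matrix (Fin m₁) (Fin m₂) ℝ) :
    finner A B = finner B A := by
  simp only [finner, mul_comm]

theorem finner_add_smul_left {m₁ m₂ : ℕ} (A B C : Matrix (Fin m₁) (Fin m₂) ℝ) (c : ℝ) :
    finner (A + c • B) C = finner A C + c * finner B C := by
  simp only [finner, Matrix.add_apply, Matrix.smul_apply, smul_eq_mul, Finset.mul_sum,
    ← Finset.sum_add_distrib, add_mul, mul_assoc]

theorem finner_mul_mul_transpose {m₁ m₂ s₁ s₂ : ℕ} (U : Matrix (Fin m₁) (Fin s₁) ℝ)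
    (V : Matrix (Fin m₂) (Fin s₂) ℝ) (A : Matrix (Fin s₁) (Fin s₂) ℝ)
    (B : Matrix (Fin m₁) (Fin m₂) ℝ) :
    finner (U * A * Vᵀ) B = finner A (Uᵀ * B * V) := by
  rw [finner_eq_trace, finner_eq_trace, Matrix.transpose_mul, Matrix.transpose_mul,
    Matrix.transpose_transpose, Matrix.mul_assoc, Matrix.trace_mul_comm]
  simp only [Matrix.mul_assoc]

theorem finner_self_nonneg {m₁ m₂ : ℕ} (A : Matrix (Fin m₁) (Fin m₂) ℝ) : 0 ≤ finner A A :=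
  Finset.sum_nonneg fun _ _ => Finset.sum_nonneg fun _ _ => mul_self_nonneg _

theorem fnorm_nonneg {m₁ m₂ : ℕ} (A : Matrix (Fin m₁) (Fin m₂) ℝ) : 0 ≤ fnorm A :=
  Real.sqrt_nonneg _

theorem fnorm_sq {m₁ m₂ : ℕ} (A : Matrix (Fin m₁) (Fin m₂) ℝ) : fnorm A ^ 2 = finner A A :=
  Real.sq_sqrt (finner_self_nonneg A)

/-- Cauchy–Schwarz for the Frobenius inner product. -/
theorem finner_le_fnorm_mul_fnorm {m₁ m₂ : ℕ} (A B : Matrix (Fin m₁) (Fin m₂) ℝ) :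
    finner A B ≤ fnorm A * fnorm B := by
  have h := Real.sum_mul_le_sqrt_mul_sqrt (Finset.univ : Finset (Fin m₁ × Fin m₂))
    (fun p => A p.1 p.2) (fun p => B p.1 p.2)
  simpa only [fnorm, finner, Fintype.sum_prod_type, pow_two] using h

theorem stmt_1 {m₁ m₂ s₁ s₂ : ℕ} (α : ℝ)
    (F : Matrix (Fin m₁) (Fin m₂) ℝ → ℝ → Matrix (Fin m₁) (Fin m₂) ℝ)
    (hF : ∀ Y t, finner (F Y t) Y ≤ α * (fnorm Y) ^ 2)
    (U : Matrix (Fin m₁) (Fin s₁) ℝ) (V : Matrix (Fin m₂) (Fin s₂) ℝ)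
    (hU : Uᵀ * U = 1) (hV : Vᵀ * V = 1)
    (Δt : ℝ) (hΔt : 0 ≤ Δt) (hαΔt : α * Δt < 1)
    (Xn : Matrix (Fin m₁) (Fin m₂) ℝ) (t : ℝ)
    (S : Matrix (Fin s₁) (Fin s₂) ℝ)
    (hfix : S = Uᵀ * (Xn + Δt • F (U * S * Vᵀ) t) * V) :
    fnorm (U * S * Vᵀ) ≤ (1 - α * Δt)⁻¹ * fnorm Xn ∧
      ∀ Xn1 : Matrix (Fin m₁) (Fin m₂) ℝ,
        fnorm Xn1 ≤ fnorm (U * S * Vᵀ) →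
          fnorm Xn1 ≤ (1 - α * Δt)⁻¹ * fnorm Xn := by
  have key : fnorm (U * S * Vᵀ) ≤ (1 - α * Δt)⁻¹ * fnorm Xn := by
    set Y := U * S * Vᵀ with hY
    have hYS : Uᵀ * Y * V = S := by
      rw [hY, show Uᵀ * (U * S * Vᵀ) * V = (Uᵀ * U) * S * (Vᵀ * V) by
        simp only [Matrix.mul_assoc], hU, hV, Matrix.one_mul, Matrix.mul_one]
    have henergy : finner Y Y = finner Xn Y + Δt * finner (F Y t) Y := by
      rw [← finner_add_smul_left, finner_comm (Xn + _) Y]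
      calc finner Y Y = finner S (Uᵀ * Y * V) := finner_mul_mul_transpose U V S Y
        _ = finner S (Uᵀ * (Xn + Δt • F Y t) * V) := by rw [hYS, ← hfix]
        _ = finner Y (Xn + Δt • F Y t) := (finner_mul_mul_transpose U V S _).symm
    have hCS := finner_le_fnorm_mul_fnorm Xn Y
    have hdiss := mul_le_mul_of_nonneg_left (hF Y t) hΔt
    rw [← fnorm_sq] at henergy
    have hpos : 0 < 1 - α * Δt := by linarith
    rw [inv_mul_eq_div, le_div_iff₀ hpos]
    rcases (fnorm_nonneg Y).eq_or_lt with h0 | h0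
    · rw [← h0, zero_mul]
      exact fnorm_nonneg Xn
    · refine le_of_mul_le_mul_right ?_ h0
      linarith
  exact ⟨key, fun _ h => h.trans key⟩
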